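/- (Negative part of an antisymmetric supersolution is a subsolution.) Let H ⊂ ℝ^d be an open half-space, Ω ⊂ H, g continuous, and let u be a bounded antisymmetric (with respect to H) viscosity supersolution of Ψ(−Δ)u = g in Ω with u ≥ 0 in H∖Ω. Define Σ = {u < 0} ∩ Ω and v = −u on Σ, v = 0 on ℝ^d∖Σ. Then Σ is open, v is upper semicontinuous, and −Ψ(−Δ)v ≥ g in Σ in the viscosity sense: for every x ∈ Σ and every bounded test function φ that is C² near x with φ(x) = v(x) and φ > v on ℝ^d∖{x}, one has −Ψ(−Δ)φ(x) ≥ g(x). -/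

import Mathlib

open MeasureTheory Set Filter Metric Asymptotics
open scoped RealInnerProductSpace ENNReal Topology NNReal

noncomputable section

abbrev Rd (d : ℕ) := EuclideanSpace ℝ (Fin d)

/-- The data of a Bernstein function `Ψ` vanishing at `0`, its Lévy measure `𝔪`,
and the weak scaling conditions. -/
structure PsiSetting (d : ℕ) where
  Ψ : ℝ → ℝ
  m : Measure ℝ
  m_onIoi : m (Set.Iic 0) = 0
  smooth : ContDiffOn ℝ (⊤ : ℕ∞) Ψ (Set.Ioi 0)
  nonneg : ∀ x > (0:ℝ), 0 ≤ Ψ x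
  deriv_alt : ∀ n : ℕ, ∀ x > (0:ℝ),
    (-1 : ℝ) ^ (n + 1) * iteratedDerivWithin (n + 1) Ψ (Set.Ioi 0) x ≤ 0
  zero_lim : Filter.Tendsto Ψ (nhdsWithin 0 (Set.Ioi 0)) (nhds 0)
  levy_rep : ∀ lam > (0:ℝ), Ψ lam = ∫ t, (1 - Real.exp (-lam * t)) ∂m
  a₁ : ℝ
  a₂ : ℝ
  b₁ : ℝ
  b₂ : ℝ
  ha₁ : 0 < a₁
  ha₁₂ : a₁ ≤ a₂
  ha₂ : a₂ < 1
  hb₁ : 1 ≤ b₁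
  hb₂ : 1 < b₂
  scaling_lower : ∀ r R : ℝ, 1 ≤ r → r ≤ R → (1 / b₁) * (R / r) ^ a₁ ≤ Ψ R / Ψ r
  scaling_upper : ∀ r R : ℝ, 1 ≤ r → r ≤ R → Ψ R / Ψ r ≤ b₁ * (R / r) ^ a₂

/-- The jump kernel `j(r) = ∫_0^∞ (4πt)^{-d/2} e^{-r²/(4t)} 𝔪(dt)`. -/
def PsiSetting.j {d : ℕ} (S : PsiSetting d) (r : ℝ) : ℝ :=
  ∫ t, (4 * Real.pi * t) ^ (-(d : ℝ) / 2) * Real.exp (-(r ^ 2) / (4 * t)) ∂S.m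

/-- The condition `j(r) ≤ b₂ j(r+1)` for `r ≥ 1`. -/
def PsiSetting.kernelCond {d : ℕ} (S : PsiSetting d) : Prop :=
  ∀ r : ℝ, 1 ≤ r → S.j r ≤ S.b₂ * S.j (r + 1)

/-- The nonlocal operator `Ψ(−Δ)` applied to a test function. -/
def psiOp {d : ℕ} (S : PsiSetting d) (φ : Rd d → ℝ) (x : Rd d) : ℝ :=
  ∫ z : Rd d,
    (φ x - φ (x + z) + (if ‖z‖ ≤ 1 then ⟪z, gradient φ x⟫ else 0)) * S.j ‖z‖

/-- Admissible test functions at `x`: bounded continuous and C² near `x`. -/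
def TestAt {d : ℕ} (x : Rd d) (φ : Rd d → ℝ) : Prop :=
  (∃ M, ∀ y, |φ y| ≤ M) ∧ Continuous φ ∧ ∃ U ∈ nhds x, ContDiffOn ℝ 2 φ U

/-- Viscosity supersolution of `Ψ(−Δ)u + c·u = g` in `Ω`. -/
def IsSuperSol {d : ℕ} (S : PsiSetting d) (Ω : Set (Rd d)) (c g u : Rd d → ℝ) : Prop :=
  LowerSemicontinuous u ∧
    ∀ x ∈ Ω, ∀ φ : Rd d → ℝ, TestAt x φ → φ x = u x → (∀ y, y ≠ x → φ y < u y) →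
      g x ≤ psiOp S φ x + c x * u x

/-- Viscosity subsolution of `Ψ(−Δ)u + c·u = g` in `Ω`. -/
def IsSubSol {d : ℕ} (S : PsiSetting d) (Ω : Set (Rd d)) (c g u : Rd d → ℝ) : Prop :=
  UpperSemicontinuous u ∧
    ∀ x ∈ Ω, ∀ φ : Rd d → ℝ, TestAt x φ → φ x = u x → (∀ y, y ≠ x → u y < φ y) →
      psiOp S φ x + c x * u x ≤ g x

/-- Viscosity solution of `Ψ(−Δ)u + c·u = g` in `Ω`. -/
def IsSol {d : ℕ} (S : PsiSetting d) (Ω : Set (Rd d)) (c g u : Rd d → ℝ) : Prop :=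
  IsSubSol S Ω c g u ∧ IsSuperSol S Ω c g u

/-- `V` is the renewal function of the ascending ladder-height process associated with `Ψ`. -/
structure IsRenewal (Ψ V : ℝ → ℝ) : Prop where
  nonneg : ∀ x, 0 ≤ V x
  zero : ∀ x ≤ (0:ℝ), V x = 0
  cont : ContinuousOn V (Set.Ioi 0)
  mono : StrictMonoOn V (Set.Ioi 0)
  laplace : ∀ s : ℝ, 0 < s →
    (∫ x in Set.Ioi (0 : ℝ), V x * Real.exp (-s * x)) =
      1 / (s * Real.exp ((1 / Real.pi) *
        ∫ y in Set.Ioi (0 : ℝ), Real.log (Ψ (s * y)) / (1 + y ^ 2)))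

/-- `tr_V(u)(x) = t`: the `V`-trace of `u` at the boundary point `x` of `D`. -/
def HasVTrace {d : ℕ} (V : ℝ → ℝ) (D : Set (Rd d)) (u : Rd d → ℝ)
    (x : Rd d) (t : ℝ) : Prop :=
  Filter.Tendsto (fun z => u z / V (Metric.infDist z Dᶜ)) (nhdsWithin x D) (nhds t)

/-- An open set has C² boundary. -/
def HasC2Boundary {d : ℕ} (D : Set (Rd d)) : Prop :=
  ∀ x ∈ frontier D, ∃ (U : Set (Rd d)) (f : Rd d → ℝ),
    IsOpen U ∧ x ∈ U ∧ ContDiffOn ℝ 2 f U ∧ (∀ y ∈ U, fderiv ℝ f y ≠ 0) ∧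
      D ∩ U = {y ∈ U | f y < 0}

/-- A closed set has C² boundary. -/
def HasC2BoundaryClosed {d : ℕ} (G : Set (Rd d)) : Prop :=
  ∀ x ∈ frontier G, ∃ (U : Set (Rd d)) (f : Rd d → ℝ),
    IsOpen U ∧ x ∈ U ∧ ContDiffOn ℝ 2 f U ∧ (∀ y ∈ U, fderiv ℝ f y ≠ 0) ∧
      G ∩ U = {y ∈ U | f y ≤ 0}

/-- Reflection `R_{λ,e}` across the hyperplane `{x·e = λ}`. -/
def reflAt {d : ℕ} (e : Rd d) (lam : ℝ) (x : Rd d) : Rd d :=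
  x - (2 * ⟪x, e⟫ - 2 * lam) • e

/-- The open half-space `H_{λ,e} = {x·e > λ}`. -/
def halfSpace {d : ℕ} (e : Rd d) (lam : ℝ) : Set (Rd d) := {x | lam < ⟪x, e⟫}

/-- A function is antisymmetric with respect to the half-space `H_{λ,e}`. -/
def AntiSym {d : ℕ} (e : Rd d) (lam : ℝ) (u : Rd d → ℝ) : Prop :=
  ∀ x, u x = - u (reflAt e lam x)

theorem PsiSetting.ae_pos {d : ℕ} (S : PsiSetting d) : ∀ᵐ t ∂S.m, 0 < t := by
  rw [ae_iff]
  convert! S.m_onIoi using 2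
  ext t
  simp

theorem PsiSetting.integrable_one_sub_exp {d : ℕ} (S : PsiSetting d) :
    Integrable (fun t => 1 - Real.exp (-t)) S.m := by
  by_contra h
  have h1 := S.levy_rep 1 one_pos
  simp only [neg_mul, one_mul] at h1
  rw [integral_undef h] at h1
  have h2 := S.scaling_lower 1 1 le_rfl le_rfl
  rw [h1] at h2
  have := S.hb₁
  have h3 : (0 : ℝ) < 1 / S.b₁ := by positivity
  simp at h2
  linarith

theorem PsiSetting.sigmaFinite {d : ℕ} (S : PsiSetting d) : SigmaFinite S.m := by
  have hf := S.integrable_one_sub_exp.aefinStronglyMeasurable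
  have h := hf.sigmaFinite_restrict
  have h0 := hf.ae_eq_zero_compl
  rw [Filter.EventuallyEq, ae_restrict_iff' hf.measurableSet.compl] at h0
  have h1 : ∀ᵐ t ∂S.m, t ∈ hf.sigmaFiniteSet := by
    filter_upwards [h0, S.ae_pos] with t ht hpos
    by_contra hmem
    have h2 := ht hmem
    have h3 : Real.exp (-t) < 1 := by simpa using hpos
    simp only [Pi.zero_apply] at h2
    linarith
  rwa [Measure.restrict_eq_self_of_ae_mem h1] at h

/-- The Gaussian kernel subordinated by the jump kernel `j`. -/
def gaussKernel (d : ℕ) (r t : ℝ) : ℝ :=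
  (4 * Real.pi * t) ^ (-(d : ℝ) / 2) * Real.exp (-(r ^ 2) / (4 * t))

theorem gaussKernel_nonneg (d : ℕ) (r : ℝ) {t : ℝ} (ht : 0 < t) : 0 ≤ gaussKernel d r t := by
  unfold gaussKernel
  positivity

theorem gaussKernel_antitone (d : ℕ) {r s t : ℝ} (hr : 0 ≤ r) (hrs : r ≤ s) (ht : 0 < t) :
    gaussKernel d s t ≤ gaussKernel d r t := by
  unfold gaussKernel
  gcongr

/-- A Gaussian majorant of the kernel away from the origin. -/
def gaussMajorant (d : ℕ) (δ r t : ℝ) : ℝ :=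
  (4 * Real.pi * t) ^ (-(d : ℝ) / 2) * Real.exp (-(δ ^ 2 / (8 * t))) *
    Real.exp (-(1 / (8 * t)) * r ^ 2)

theorem gaussMajorant_nonneg (d : ℕ) (δ r : ℝ) {t : ℝ} (ht : 0 < t) :
    0 ≤ gaussMajorant d δ r t := by
  unfold gaussMajorant
  positivity

theorem gaussKernel_le_majorant (d : ℕ) {δ r t : ℝ} (hδ : 0 ≤ δ) (hr : δ ≤ r) (ht : 0 < t) :
    gaussKernel d r t ≤ gaussMajorant d δ r t := by
  unfold gaussKernel gaussMajorant
  rw [mul_assoc ((4 * Real.pi * t) ^ _), ← Real.exp_add]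
  gcongr
  have h : δ ^ 2 ≤ r ^ 2 := by gcongr
  have h2 : -(r ^ 2) / (4 * t) = -(r ^ 2 / (8 * t)) + -(1 / (8 * t)) * r ^ 2 := by
    field_simp
    ring
  rw [h2]
  gcongr

theorem exp_neg_div_le {a t : ℝ} (ha : 0 < a) (ht : 0 < t) :
    Real.exp (-(a / t)) ≤ (1 + 1 / a) * (1 - Real.exp (-t)) := by
  have h1 : Real.exp (-(a / t)) ≤ t / (t + a) := by
    rw [Real.exp_neg, inv_le_comm₀ (Real.exp_pos _) (by positivity), inv_div]
    have := Real.add_one_le_exp (a / t)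
    have h : (t + a) / t = a / t + 1 := by field_simp; ring
    linarith
  have h2 : t / (1 + t) ≤ 1 - Real.exp (-t) := by
    have h3 : Real.exp (-t) ≤ 1 / (1 + t) := by
      rw [Real.exp_neg, ← one_div]
      gcongr
      linarith [Real.add_one_le_exp t]
    have h4 : t / (1 + t) = 1 - 1 / (1 + t) := by field_simp; ring
    linarith
  refine h1.trans (le_trans ?_ (mul_le_mul_of_nonneg_left h2 (by positivity)))
  rw [← mul_div_assoc, div_le_div_iff₀ (by positivity) (by positivity)]
  have h5 : (1 + 1 / a) * t * (t + a) = t * (1 + t) + t * (a + t / a) := by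
    field_simp
    ring
  rw [h5]
  have : 0 ≤ t * (a + t / a) := by positivity
  linarith

theorem integral_gaussMajorant (d : ℕ) (δ : ℝ) {t : ℝ} (ht : 0 < t) :
    ∫ z : Rd d, gaussMajorant d δ ‖z‖ t =
      (2 : ℝ) ^ ((d : ℝ) / 2) * Real.exp (-(δ ^ 2 / (8 * t))) := by
  unfold gaussMajorant
  rw [integral_const_mul, GaussianFourier.integral_rexp_neg_mul_sq_norm (by positivity)]
  rw [finrank_euclideanSpace_fin]
  have h : Real.pi / (1 / (8 * t)) = 2 * (4 * Real.pi * t) := by field_simp; norm_num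
  have hp : 0 < 4 * Real.pi * t := by positivity
  rw [h, Real.mul_rpow (by norm_num) hp.le, neg_div, Real.rpow_neg hp.le]
  have : (4 * Real.pi * t) ^ ((d : ℝ) / 2) ≠ 0 := by positivity
  field_simp

theorem integrable_gaussMajorant (d : ℕ) (δ : ℝ) {t : ℝ} (ht : 0 < t) :
    Integrable (fun z : Rd d => gaussMajorant d δ ‖z‖ t) := by
  by_contra h
  have h1 := integral_gaussMajorant d δ ht
  rw [integral_undef h] at h1
  have : 0 < (2 : ℝ) ^ ((d : ℝ) / 2) * Real.exp (-(δ ^ 2 / (8 * t))) := by positivity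
  linarith

theorem PsiSetting.integrable_gaussMajorant_prod {d : ℕ} (S : PsiSetting d) {δ : ℝ}
    (hδ : 0 < δ) :
    Integrable (fun p : Rd d × ℝ => gaussMajorant d δ ‖p.1‖ p.2) (volume.prod S.m) := by
  have := S.sigmaFinite
  have hmeas : Measurable (fun p : Rd d × ℝ => gaussMajorant d δ ‖p.1‖ p.2) := by
    unfold gaussMajorant
    fun_prop
  rw [integrable_prod_iff' hmeas.aestronglyMeasurable]
  constructor
  · filter_upwards [S.ae_pos] with t ht using integrable_gaussMajorant d δ ht
  · have hdom := (S.integrable_one_sub_exp.const_mul (1 + 1 / (δ ^ 2 / 8))).const_mul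
      ((2 : ℝ) ^ ((d : ℝ) / 2))
    refine hdom.mono' ?_ ?_
    · exact (StronglyMeasurable.integral_prod_left
        (f := fun (z : Rd d) (t : ℝ) => ‖gaussMajorant d δ ‖z‖ t‖)
        hmeas.norm.stronglyMeasurable).aestronglyMeasurable
    · filter_upwards [S.ae_pos] with t ht
      have h1 : ∫ z : Rd d, ‖gaussMajorant d δ ‖z‖ t‖ = ∫ z : Rd d, gaussMajorant d δ ‖z‖ t := by
        congr 1
        ext z
        exact Real.norm_of_nonneg (gaussMajorant_nonneg d δ _ ht)
      rw [h1, integral_gaussMajorant d δ ht, Real.norm_of_nonneg (by positivity)]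
      gcongr
      have h2 := exp_neg_div_le (a := δ ^ 2 / 8) (by positivity) ht
      rwa [div_div] at h2

theorem PsiSetting.j_nonneg {d : ℕ} (S : PsiSetting d) (r : ℝ) : 0 ≤ S.j r := by
  refine integral_nonneg_of_ae ?_
  filter_upwards [S.ae_pos] with t ht using gaussKernel_nonneg d r ht

theorem PsiSetting.stronglyMeasurable_j_norm {d : ℕ} (S : PsiSetting d) :
    StronglyMeasurable (fun z : Rd d => S.j ‖z‖) := by
  have := S.sigmaFinite
  refine StronglyMeasurable.integral_prod_right (f := fun (z : Rd d) (t : ℝ) =>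
    (4 * Real.pi * t) ^ (-(d : ℝ) / 2) * Real.exp (-(‖z‖ ^ 2) / (4 * t))) ?_
  refine Measurable.stronglyMeasurable ?_
  fun_prop

/-- The jump kernel is integrable away from the origin, against bounded functions. -/
theorem PsiSetting.integrable_mul_j {d : ℕ} (S : PsiSetting d) {δ : ℝ} (hδ : 0 < δ)
    {f : Rd d → ℝ} (hf : Continuous f) {M : ℝ} (hM : ∀ z, |f z| ≤ M)
    (h0 : ∀ z, ‖z‖ < δ → f z = 0) :
    Integrable (fun z => f z * S.j ‖z‖) := by
  have := S.sigmaFinite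
  have hG := S.integrable_gaussMajorant_prod hδ
  refine (hG.integral_prod_left.const_mul M).mono'
    (hf.aestronglyMeasurable.mul S.stronglyMeasurable_j_norm.aestronglyMeasurable) ?_
  filter_upwards [hG.prod_right_ae] with z hz
  have hnn : 0 ≤ ∫ t, gaussMajorant d δ ‖z‖ t ∂S.m := by
    refine integral_nonneg_of_ae ?_
    filter_upwards [S.ae_pos] with t ht using gaussMajorant_nonneg d δ _ ht
  have hM0 : 0 ≤ M := (abs_nonneg _).trans (hM 0)
  rcases lt_or_ge ‖z‖ δ with h | h
  · simp only [h0 z h, zero_mul, norm_zero]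
    positivity
  · rw [norm_mul, Real.norm_eq_abs, Real.norm_of_nonneg (S.j_nonneg _)]
    refine mul_le_mul (hM z) ?_ (S.j_nonneg _) hM0
    refine integral_mono_of_nonneg ?_ hz ?_
    · filter_upwards [S.ae_pos] with t ht using gaussKernel_nonneg d ‖z‖ ht
    · filter_upwards [S.ae_pos] with t ht using gaussKernel_le_majorant d hδ.le h ht

/-- Off a null set of centers, the jump kernel is nonincreasing beyond distance `δ`. -/
theorem PsiSetting.ae_j_antitone {d : ℕ} (S : PsiSetting d) {δ : ℝ} (hδ : 0 < δ) :
    ∀ᵐ z : Rd d, δ ≤ ‖z‖ → ∀ s, ‖z‖ ≤ s → S.j s ≤ S.j ‖z‖ := by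
  have := S.sigmaFinite
  have hG := S.integrable_gaussMajorant_prod hδ
  filter_upwards [hG.prod_right_ae] with z hz hδz s hs
  refine integral_mono_of_nonneg (f := gaussKernel d s) (g := gaussKernel d ‖z‖) ?_ ?_ ?_
  · filter_upwards [S.ae_pos] with t ht using gaussKernel_nonneg d s ht
  · refine hz.mono' ?_ ?_
    · refine Measurable.aestronglyMeasurable ?_
      unfold gaussKernel
      fun_prop
    · filter_upwards [S.ae_pos] with t ht
      rw [Real.norm_of_nonneg (gaussKernel_nonneg d _ ht)]
      exact gaussKernel_le_majorant d hδ.le hδz ht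
  · filter_upwards [S.ae_pos] with t ht using gaussKernel_antitone d (norm_nonneg _) hs ht

theorem inner_reflAt {d : ℕ} {e : Rd d} (he : ‖e‖ = 1) (lam : ℝ) (x : Rd d) :
    ⟪reflAt e lam x, e⟫ = 2 * lam - ⟪x, e⟫ := by
  rw [reflAt, inner_sub_left, real_inner_smul_left, real_inner_self_eq_norm_sq, he]
  ring

theorem reflAt_reflAt {d : ℕ} {e : Rd d} (he : ‖e‖ = 1) (lam : ℝ) (x : Rd d) :
    reflAt e lam (reflAt e lam x) = x := by
  rw [reflAt, inner_reflAt he, reflAt, sub_sub, ← add_smul]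
  ring_nf
  simp

theorem reflAt_add_left {d : ℕ} (e : Rd d) (lam : ℝ) (x z : Rd d) :
    reflAt e lam (x + z) = x + reflAt e (lam - ⟪x, e⟫) z := by
  rw [reflAt, reflAt, inner_add_left, add_sub_assoc]
  ring_nf

theorem norm_reflAt_sq {d : ℕ} {e : Rd d} (he : ‖e‖ = 1) (mu : ℝ) (z : Rd d) :
    ‖reflAt e mu z‖ ^ 2 = ‖z‖ ^ 2 - 4 * mu * (⟪z, e⟫ - mu) := by
  rw [reflAt, norm_sub_sq_real, inner_smul_right, norm_smul, he, Real.norm_eq_abs, mul_one, sq_abs]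
  ring

theorem norm_le_norm_reflAt {d : ℕ} {e : Rd d} (he : ‖e‖ = 1) {mu : ℝ} (hmu : mu ≤ 0)
    {z : Rd d} (hz : mu ≤ ⟪z, e⟫) : ‖z‖ ≤ ‖reflAt e mu z‖ := by
  refine le_of_sq_le_sq ?_ (norm_nonneg _)
  rw [norm_reflAt_sq he]
  nlinarith

theorem continuous_reflAt {d : ℕ} (e : Rd d) (lam : ℝ) : Continuous (reflAt e lam) := by
  unfold reflAt
  fun_prop

theorem measurePreserving_reflAt {d : ℕ} {e : Rd d} (he : ‖e‖ = 1) (lam : ℝ) :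
    MeasurePreserving (reflAt e lam) := by
  have h1 : MeasurePreserving (fun x : Rd d => (ℝ ∙ e)ᗮ.reflection x) :=
    (ℝ ∙ e)ᗮ.reflection.measurePreserving
  have h2 := (measurePreserving_add_right (volume : Measure (Rd d)) ((2 * lam) • e)).comp h1
  convert! h2 using 1
  ext1 x
  simp only [Function.comp_apply, Submodule.reflection_orthogonal_apply,
    Submodule.reflection_singleton_apply, he, reflAt, real_inner_comm e x]
  simp only [sub_smul, mul_smul, two_smul]
  simp
  abel

theorem measurableEmbedding_reflAt {d : ℕ} {e : Rd d} (he : ‖e‖ = 1) (lam : ℝ) :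
    MeasurableEmbedding (reflAt e lam) :=
  (Homeomorph.mk ⟨reflAt e lam, reflAt e lam, reflAt_reflAt he lam, reflAt_reflAt he lam⟩
    (continuous_reflAt e lam) (continuous_reflAt e lam)).measurableEmbedding

/-- If `f` is nonnegative on a half-space containing the origin and dominates there the negative of
its reflection, then the integral of `f` against the jump kernel is nonnegative. -/
theorem PsiSetting.integral_mul_j_nonneg {d : ℕ} (S : PsiSetting d) {δ : ℝ} (hδ : 0 < δ)
    {e : Rd d} (he : ‖e‖ = 1) {mu : ℝ} (hmu : mu ≤ 0) {f : Rd d → ℝ}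
    (hint : Integrable (fun z => f z * S.j ‖z‖))
    (h0 : ∀ z, ‖z‖ < δ → f z = 0) (hpos : ∀ z, mu ≤ ⟪z, e⟫ → 0 ≤ f z)
    (hsum : ∀ z, 0 ≤ f z + f (reflAt e mu z)) :
    0 ≤ ∫ z, f z * S.j ‖z‖ := by
  have hR := measurePreserving_reflAt he mu
  have hE := measurableEmbedding_reflAt he mu
  have heq := hR.integral_comp hE (fun z => f z * S.j ‖z‖)
  have hint' : Integrable (fun z => f (reflAt e mu z) * S.j ‖reflAt e mu z‖) :=
    (hR.integrable_comp_emb hE).2 hint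
  have key : ∀ z, mu ≤ ⟪z, e⟫ → (δ ≤ ‖z‖ → ∀ s, ‖z‖ ≤ s → S.j s ≤ S.j ‖z‖) →
      0 ≤ f z * S.j ‖z‖ + f (reflAt e mu z) * S.j ‖reflAt e mu z‖ := by
    intro z hz hj
    have hs := hsum z
    have hj1 := S.j_nonneg ‖reflAt e mu z‖
    rcases lt_or_ge ‖z‖ δ with h | h
    · rw [h0 z h] at hs ⊢
      rw [zero_add] at hs
      rw [zero_mul, zero_add]
      positivity
    · have h1 := hj h _ (norm_le_norm_reflAt he hmu hz)
      nlinarith [mul_nonneg (hpos z hz) (sub_nonneg.2 h1), mul_nonneg hs hj1]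
  have hnn : 0 ≤ ∫ z, (f z * S.j ‖z‖ + f (reflAt e mu z) * S.j ‖reflAt e mu z‖) := by
    refine integral_nonneg_of_ae ?_
    have hae := S.ae_j_antitone hδ
    filter_upwards [hae, hR.quasiMeasurePreserving.ae hae] with z hz hz'
    rcases le_total mu ⟪z, e⟫ with h | h
    · exact key z h hz
    · have := key (reflAt e mu z) (by rw [inner_reflAt he]; linarith) hz'
      rw [reflAt_reflAt he] at this
      simpa [add_comm] using this
  rw [integral_add hint hint', heq] at hnn
  linarith

theorem gradient_eq_of_eventuallyEq {d : ℕ} {φ ψ : Rd d → ℝ} {x : Rd d} (h : ψ =ᶠ[𝓝 x] -φ) :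
    gradient ψ x = -gradient φ x := by
  simp only [gradient, h.fderiv_eq, fderiv_neg, map_neg]

/-- Adding a function that vanishes near `x` changes `psiOp` by its integral against the kernel. -/
theorem psiOp_neg_add_le {d : ℕ} (S : PsiSetting d) {φ w : Rd d → ℝ} {x : Rd d} {g : ℝ}
    (hw : w =ᶠ[𝓝 x] 0) (hint : Integrable (fun z => w (x + z) * S.j ‖z‖))
    (hnn : 0 ≤ ∫ z, w (x + z) * S.j ‖z‖) (hg : g ≤ psiOp S (fun y => -φ y + w y) x) :
    g ≤ -psiOp S φ x := by
  have hgrad : gradient (fun y => -φ y + w y) x = -gradient φ x := by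
    refine gradient_eq_of_eventuallyEq ?_
    filter_upwards [hw] with y hy
    simp [hy]
  have hwx : w x = 0 := hw.self_of_nhds
  set A : Rd d → ℝ := fun z =>
    (φ x - φ (x + z) + (if ‖z‖ ≤ 1 then ⟪z, gradient φ x⟫ else 0)) * S.j ‖z‖ with hA
  have hEq : psiOp S (fun y => -φ y + w y) x = ∫ z, (-A z + -(w (x + z) * S.j ‖z‖)) := by
    unfold psiOp
    refine integral_congr_ae (.of_forall fun z => ?_)
    simp only [hgrad, hA, hwx, inner_neg_right]
    split_ifs <;> ring
  rw [hEq] at hg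
  have hφ : psiOp S φ x = ∫ z, A z := rfl
  rw [hφ]
  by_cases hAi : Integrable A
  · rw [integral_add hAi.fun_neg hint.fun_neg, integral_neg, integral_neg] at hg
    linarith
  · rw [integral_undef hAi]
    rwa [integral_undef, ← neg_zero] at hg
    rw [integrable_add_iff_integrable_left' hint.fun_neg]
    exact fun h => hAi (by simpa using h.fun_neg)

theorem AntiSym.continuous {d : ℕ} {e : Rd d} {lam : ℝ} {u : Rd d → ℝ}
    (hanti : AntiSym e lam u) (hu : LowerSemicontinuous u) : Continuous u := by
  rw [continuous_iff_lower_upperSemicontinuous]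
  refine ⟨hu, ?_⟩
  have h1 : LowerSemicontinuous (u ∘ reflAt e lam) := hu.comp (continuous_reflAt e lam)
  have h2 := continuous_neg.comp_lowerSemicontinuous_antitone h1 (fun _ _ h => neg_le_neg h)
  convert! h2 using 1
  ext1 x
  exact hanti x

theorem negativePart_eq {d : ℕ} {e : Rd d} {lam : ℝ} {Ω : Set (Rd d)}
    (hΩ : Ω ⊆ halfSpace e lam) {u : Rd d → ℝ}
    (hnonneg : ∀ x ∈ halfSpace e lam \ Ω, 0 ≤ u x) :
    {x | u x < 0} ∩ Ω = {x | u x < 0} ∩ halfSpace e lam := by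
  ext x
  refine ⟨fun h => ⟨h.1, hΩ h.2⟩, fun h => ⟨h.1, ?_⟩⟩
  by_contra hx
  exact absurd (hnonneg x ⟨h.2, hx⟩) (not_le.2 h.1)

theorem AntiSym.eq_zero {d : ℕ} {e : Rd d} {lam : ℝ} {u : Rd d → ℝ}
    (hanti : AntiSym e lam u) {x : Rd d} (hx : ⟪x, e⟫ = lam) : u x = 0 := by
  have h := hanti x
  have hr : reflAt e lam x = x := by simp [reflAt, hx]
  rw [hr] at h
  linarith

theorem continuous_negativePart {d : ℕ} {e : Rd d} {lam : ℝ} {u : Rd d → ℝ}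
    (hanti : AntiSym e lam u) (hu : Continuous u) :
    Continuous (({x | u x < 0} ∩ halfSpace e lam).indicator (fun x => -u x)) := by
  have h : Continuous fun x => if ⟪x, e⟫ ≤ lam then (0 : ℝ) else max (-u x) 0 := by
    refine Continuous.if_le (by fun_prop) (by fun_prop) (by fun_prop) (by fun_prop) ?_
    intro x hx
    simp [hanti.eq_zero hx]
  convert! h using 1
  ext1 x
  by_cases hx : lam < ⟪x, e⟫
  · rcases lt_or_ge (u x) 0 with hux | hux
    · have hmem : x ∈ {x | u x < 0} ∩ halfSpace e lam := ⟨hux, hx⟩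
      rw [indicator_of_mem hmem, if_neg (not_le.2 hx), max_eq_left (by linarith)]
    · rw [indicator_of_notMem fun h => not_lt.2 hux h.1, if_neg (not_le.2 hx),
        max_eq_right (by linarith)]
  · rw [indicator_of_notMem fun h => hx h.2, if_pos (not_lt.1 hx)]

/-- **Equation (3.2)/(A3)**: the negative part of a bounded antisymmetric
viscosity supersolution of `Ψ(−Δ)u = g` in `Ω ⊂ H` with `u ≥ 0` on `H∖Ω`,
extended by `0` outside `Σ = {u < 0} ∩ Ω`, is upper semicontinuous, `Σ` is
open, and `−Ψ(−Δ)v ≥ g` holds in `Σ` in the viscosity sense. -/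
theorem negative_part_is_subsolution
    {d : ℕ} (hd : 2 ≤ d) (S : PsiSetting d) (hker : S.kernelCond)
    (e : Rd d) (he : ‖e‖ = 1) (lam : ℝ)
    (Ω : Set (Rd d)) (hΩ : Ω ⊆ halfSpace e lam)
    (g : Rd d → ℝ) (hg : Continuous g)
    (u : Rd d → ℝ) (hub : ∃ M, ∀ x, |u x| ≤ M)
    (hanti : AntiSym e lam u)
    (hsup : IsSuperSol S Ω (fun _ => 0) g u)
    (hnonneg : ∀ x ∈ halfSpace e lam \ Ω, 0 ≤ u x) :
    IsOpen ({x | u x < 0} ∩ Ω) ∧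
    UpperSemicontinuous (({x | u x < 0} ∩ Ω).indicator (fun x => -u x)) ∧
    (∀ x ∈ {x | u x < 0} ∩ Ω, ∀ φ : Rd d → ℝ, TestAt x φ →
      φ x = ({x | u x < 0} ∩ Ω).indicator (fun x => -u x) x →
      (∀ y, y ≠ x →
        ({x | u x < 0} ∩ Ω).indicator (fun x => -u x) y < φ y) →
      g x ≤ -psiOp S φ x) := by
  obtain ⟨hlsc, hvisc⟩ := hsup
  have hu : Continuous u := hanti.continuous hlsc
  rw [negativePart_eq hΩ hnonneg]
  have hopenH : IsOpen (halfSpace e lam) :=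
    isOpen_lt continuous_const (by fun_prop)
  have hopen : IsOpen ({x | u x < 0} ∩ halfSpace e lam) :=
    (isOpen_lt hu continuous_const).inter hopenH
  have hv := continuous_negativePart hanti hu
  refine ⟨hopen, hv.upperSemicontinuous, ?_⟩
  intro x hx φ hφ hφx hφlt
  have hxΩ : x ∈ Ω := by
    rw [← negativePart_eq hΩ hnonneg] at hx
    exact hx.2
  set P := {x | u x < 0} ∩ halfSpace e lam with hP
  set v := P.indicator (fun x => -u x) with hvdef
  set w : Rd d → ℝ := fun y => u y + v y with hw
  have hwP : ∀ y ∈ P, w y = 0 := fun y hy => by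
    simp [hw, hvdef, indicator_of_mem hy]
  have hwN : ∀ y ∉ P, w y = u y := fun y hy => by
    simp [hw, hvdef, indicator_of_notMem hy]
  have hwx : w =ᶠ[𝓝 x] 0 := by
    filter_upwards [hopen.mem_nhds hx] with y hy using hwP y hy
  have hwc : Continuous w := hu.add hv
  obtain ⟨M, hM⟩ := hub
  have hwM : ∀ y, |w y| ≤ M := fun y => by
    by_cases hy : y ∈ P
    · rw [hwP y hy, abs_zero]
      exact (abs_nonneg _).trans (hM y)
    · rw [hwN y hy]
      exact hM y
  have hwpos : ∀ y, lam ≤ ⟪y, e⟫ → 0 ≤ w y := fun y hy => by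
    by_cases hyP : y ∈ P
    · exact (hwP y hyP).ge
    · rw [hwN y hyP]
      rcases hy.eq_or_lt with h | h
      · exact (hanti.eq_zero h.symm).ge
      · by_contra hneg
        exact hyP ⟨not_le.1 hneg, h⟩
  have hu_reflAt : ∀ y, u (reflAt e lam y) = -u y := fun y => by
    rw [hanti y, neg_neg]
  have hle : ∀ y, u y ≤ w y := fun y => by
    by_cases hy : y ∈ P
    · rw [hwP y hy]
      exact hy.1.le
    · exact (hwN y hy).ge
  have hwsum : ∀ y, 0 ≤ w y + w (reflAt e lam y) := fun y => by
    have h1 := hle y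
    have h2 := hle (reflAt e lam y)
    rw [hu_reflAt] at h2
    linarith
  obtain ⟨δ, hδ, hball⟩ := Metric.eventually_nhds_iff.1 hwx
  have h0 : ∀ z : Rd d, ‖z‖ < δ → w (x + z) = 0 := fun z hz => hball (by simpa using hz)
  have hint := S.integrable_mul_j hδ (f := fun z => w (x + z)) (by fun_prop)
    (fun z => hwM (x + z)) h0
  have hxH : lam < ⟪x, e⟫ := hx.2
  have hnn := S.integral_mul_j_nonneg hδ he (mu := lam - ⟪x, e⟫) (by linarith)
    (f := fun z => w (x + z)) hint h0
    (fun z hz => hwpos _ (by rw [inner_add_left]; linarith))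
    (fun z => by rw [← reflAt_add_left]; exact hwsum _)
  refine psiOp_neg_add_le S hwx hint hnn ?_
  have hmain := hvisc x hxΩ (fun y => -φ y + w y) ?_ ?_ ?_
  · simpa using hmain
  · obtain ⟨⟨N, hN⟩, hφc, U, hU, hφU⟩ := hφ
    refine ⟨⟨N + M, fun y => ?_⟩, by fun_prop, U ∩ P, inter_mem hU (hopen.mem_nhds hx), ?_⟩
    · refine (abs_add_le _ _).trans ?_
      rw [abs_neg]
      exact add_le_add (hN y) (hwM y)
    · refine ((hφU.mono inter_subset_left).neg).congr fun y hy => ?_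
      simp [hwP y hy.2]
  · simp only [hφx, hw]
    ring
  · intro y hy
    have := hφlt y hy
    simp only [hw]
    linarith
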